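/- arXiv:1404.2905 — 5 statements merged into one kernel-verified Lean document; each statement's English description precedes it below -/
import Mathlib

section
/- (Compact support of Whittaker-type functions on the subgroup V_r; claim established in the proof of Proposition 6.5.) Let W : GL_{2n}(ℚ_p) → ℂ be continuous, smooth, and satisfy W(u·g) = ψ_{N_{2n}}(u)·W(g) for all u ∈ N_{2n} and g ∈ GL_{2n}(ℚ_p). Then the restriction of W to V_r has compact support, i.e., the set {r ∈ V_r : W(r) ≠ 0} has compact closure in GL_{2n}(ℚ_p). -/
open scoped MatrixGroups
open Matrix

/-- Identification of `Fin k ⊕ Fin k` with `Fin (2 * k)`. -/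
def sumEquiv (k : ℕ) : (Fin k ⊕ Fin k) ≃ Fin (2 * k) :=
  finSumFinEquiv.trans (finCongr (by omega))

/-- The `2k × 2k` matrix built from four `k × k` blocks. -/
noncomputable def blk (p : ℕ) [Fact p.Prime] {k : ℕ} (A B C D : Matrix (Fin k) (Fin k) ℚ_[p]) :
    Matrix (Fin (2 * k)) (Fin (2 * k)) ℚ_[p] :=
  Matrix.reindex (sumEquiv k) (sumEquiv k) (Matrix.fromBlocks A B C D)

/-- `g` is upper triangular with all diagonal entries equal to `1`. -/
def IsUnipUpper {R : Type*} [Zero R] [One R] {m : ℕ} (g : Matrix (Fin m) (Fin m) R) : Prop :=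
  (∀ i j : Fin m, (j : ℕ) < (i : ℕ) → g i j = 0) ∧ ∀ i : Fin m, g i i = 1

/-- The sum `g_{1,2} + g_{2,3} + ⋯ + g_{k,k+1}` of the first `k` superdiagonal entries of `g`
(1-based indexing); the argument of `ψ` in the character `ψ_{N_m}`. -/
noncomputable def sdSumUpTo {R : Type*} [AddCommMonoid R] (m k : ℕ)
    (g : Matrix (Fin m) (Fin m) R) : R :=
  ∑ i : Fin k, if h : (i : ℕ) + 1 < m then g ⟨(i : ℕ), by omega⟩ ⟨(i : ℕ) + 1, h⟩ else 0

/-- The group `V_r = {[[Iₙ, 0], [X, uᵀ]] : X` with first column zero, `u ∈ N'ₙ}`, described at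
the level of matrices. -/
def VrM (p : ℕ) [Fact p.Prime] (n : ℕ) : Set (Matrix (Fin (2 * n)) (Fin (2 * n)) ℚ_[p]) :=
  {M | ∃ X u : Matrix (Fin n) (Fin n) ℚ_[p],
    (∀ i j : Fin n, (j : ℕ) = 0 → X i j = 0) ∧ IsUnipUpper u ∧ M = blk p 1 0 X uᵀ}

theorem IsUnipUpper.submatrix_castSucc {R : Type*} [Zero R] [One R] {m : ℕ}
    {u : Matrix (Fin (m + 1)) (Fin (m + 1)) R} (hu : IsUnipUpper u) :
    IsUnipUpper (u.submatrix Fin.castSucc Fin.castSucc) :=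
  ⟨fun _ _ h => hu.1 _ _ h, fun _ => hu.2 _⟩

/-- In a product of an upper and a lower unipotent matrix, the lower factor is bounded in terms
of the product. -/
theorem exists_norm_le_of_unipUpper_mul {R : Type*} [NormedRing R] (m : ℕ) (C : ℝ) :
    ∃ B : ℝ, ∀ u r : Matrix (Fin m) (Fin m) R, IsUnipUpper u → IsUnipUpper rᵀ →
      (∀ i j, ‖(u * r) i j‖ ≤ C) → ∀ i j, ‖r i j‖ ≤ B := by
  induction m generalizing C with
  | zero => exact ⟨0, fun _ _ _ _ _ i => i.elim0⟩
  | succ m ih =>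
    obtain ⟨B, hB⟩ := ih (C + C * C)
    refine ⟨max B (max C 0), fun u r hu hr h => ?_⟩
    have hr0 : ∀ i : Fin m, r i.castSucc (Fin.last m) = 0 := fun i => hr.1 _ _ i.2
    have hr1 : r (Fin.last m) (Fin.last m) = 1 := hr.2 _
    have hu0 : ∀ i : Fin m, u (Fin.last m) i.castSucc = 0 := fun i => hu.1 _ _ i.2
    have hu1 : u (Fin.last m) (Fin.last m) = 1 := hu.2 _
    have hy : ∀ i : Fin m, ‖u i.castSucc (Fin.last m)‖ ≤ C := fun i => by
      simpa [Matrix.mul_apply, Fin.sum_univ_castSucc, hr0, hr1] using h i.castSucc (Fin.last m)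
    have hz : ∀ j, ‖r (Fin.last m) j‖ ≤ C := fun j => by
      simpa [Matrix.mul_apply, Fin.sum_univ_castSucc, hu0, hu1] using h (Fin.last m) j
    have hC : 0 ≤ C := (norm_nonneg _).trans (hz 0)
    have hsub := hB (u.submatrix Fin.castSucc Fin.castSucc) (r.submatrix Fin.castSucc Fin.castSucc)
      hu.submatrix_castSucc hr.submatrix_castSucc fun i j => by
        have e : (u.submatrix Fin.castSucc Fin.castSucc * r.submatrix Fin.castSucc Fin.castSucc) i j
            = (u * r) i.castSucc j.castSucc
              - u i.castSucc (Fin.last m) * r (Fin.last m) j.castSucc := by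
          simp [Matrix.mul_apply, Fin.sum_univ_castSucc]
        rw [e]
        refine (norm_sub_le _ _).trans (add_le_add (h _ _) ((norm_mul_le _ _).trans ?_))
        exact mul_le_mul (hy i) (hz _) (norm_nonneg _) hC
    intro i j
    induction i using Fin.lastCases with
    | last => exact (hz j).trans ((le_max_left _ _).trans (le_max_right _ _))
    | cast i =>
      induction j using Fin.lastCases with
      | last => rw [hr0, norm_zero]; exact (le_max_right _ _).trans (le_max_right _ _)
      | cast j => exact (hsub i j).trans (le_max_left _ _)

/-- The block upper triangular matrix `[[A, b], [0, d]]`. -/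
def bordered {R : Type*} [Zero R] {m : ℕ} (A : Matrix (Fin m) (Fin m) R) (b : Fin m → R) (d : R) :
    Matrix (Fin (m + 1)) (Fin (m + 1)) R :=
  Matrix.of <| Fin.snoc (α := fun _ => Fin (m + 1) → R)
    (fun i => Fin.snoc (α := fun _ => R) (A i) (b i)) (Fin.snoc (α := fun _ => R) 0 d)

section Bordered

variable {R : Type*} {m : ℕ}

@[simp]
theorem bordered_castSucc_castSucc [Zero R] (A : Matrix (Fin m) (Fin m) R) (b : Fin m → R) (d : R)
    (i j : Fin m) : bordered A b d i.castSucc j.castSucc = A i j := by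
  simp [bordered]

@[simp]
theorem bordered_castSucc_last [Zero R] (A : Matrix (Fin m) (Fin m) R) (b : Fin m → R) (d : R)
    (i : Fin m) : bordered A b d i.castSucc (Fin.last m) = b i := by
  simp [bordered]

@[simp]
theorem bordered_last_castSucc [Zero R] (A : Matrix (Fin m) (Fin m) R) (b : Fin m → R) (d : R)
    (j : Fin m) : bordered A b d (Fin.last m) j.castSucc = 0 := by
  simp [bordered]

@[simp]
theorem bordered_last_last [Zero R] (A : Matrix (Fin m) (Fin m) R) (b : Fin m → R) (d : R) :
    bordered A b d (Fin.last m) (Fin.last m) = d := by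
  simp [bordered]

theorem bordered_mul [CommRing R] (A A' : Matrix (Fin m) (Fin m) R) (b b' : Fin m → R) (d d' : R) :
    bordered A b d * bordered A' b' d' = bordered (A * A') (A *ᵥ b' + d' • b) (d * d') := by
  ext i j
  induction i using Fin.lastCases <;> induction j using Fin.lastCases <;>
    simp [Matrix.mul_apply, Fin.sum_univ_castSucc, Matrix.mulVec, dotProduct, mul_comm]

theorem det_bordered [CommRing R] (A : Matrix (Fin m) (Fin m) R) (b : Fin m → R) (d : R) :
    (bordered A b d).det = A.det * d := by
  have hA : (bordered A b d).submatrix Fin.castSucc Fin.castSucc = A := by ext; simp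
  rw [Matrix.det_succ_row _ (Fin.last m), Fin.sum_univ_castSucc]
  simp [hA, Fin.succAbove_last, mul_comm, ← two_mul]

theorem IsUnipUpper.bordered [CommRing R] {A : Matrix (Fin m) (Fin m) R} (hA : IsUnipUpper A)
    (b : Fin m → R) : IsUnipUpper (bordered A b 1) := by
  refine ⟨fun i j h => ?_, fun i => ?_⟩
  · induction i using Fin.lastCases with
    | last =>
      induction j using Fin.lastCases with
      | last => exact absurd h (lt_irrefl _)
      | cast j => simp
    | cast i =>
      induction j using Fin.lastCases with
      | last => exact absurd h (by simp)
      | cast j => simpa using hA.1 i j h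
  · induction i using Fin.lastCases with
    | last => simp
    | cast i => simpa using hA.2 i

end Bordered

section Padic

variable {p : ℕ} [Fact p.Prime]

/-- The matrix over `ℚ_[p]` underlying an element of `GL_m(ℤ_[p])`. -/
noncomputable def integralMatrix {m : ℕ} :
    GL (Fin m) ℤ_[p] →* Matrix (Fin m) (Fin m) ℚ_[p] :=
  (PadicInt.Coe.ringHom (p := p)).mapMatrix.toMonoidHom.comp (Units.coeHom _)

theorem integralMatrix_apply {m : ℕ} (k : GL (Fin m) ℤ_[p]) (i j : Fin m) :
    integralMatrix k i j = ((k : Matrix (Fin m) (Fin m) ℤ_[p]) i j : ℚ_[p]) := rfl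

theorem norm_integralMatrix_le {m : ℕ} (k : GL (Fin m) ℤ_[p]) (i j : Fin m) :
    ‖integralMatrix k i j‖ ≤ 1 :=
  PadicInt.norm_le_one _

theorem norm_det_integralMatrix {m : ℕ} (k : GL (Fin m) ℤ_[p]) :
    ‖(integralMatrix k).det‖ = 1 := by
  have h : (integralMatrix k).det = ((k : Matrix (Fin m) (Fin m) ℤ_[p]).det : ℚ_[p]) :=
    ((PadicInt.Coe.ringHom (p := p)).map_det _).symm
  rw [h, ← PadicInt.norm_def, ← PadicInt.isUnit_iff]
  exact (Matrix.isUnit_iff_isUnit_det _).1 k.isUnit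

/-- Every row vector over `ℚ_[p]` is a multiple of the last row of an element of
`GL_{m+1}(ℤ_[p])`. -/
theorem exists_integralMatrix_last_row {m : ℕ} (v : Fin (m + 1) → ℚ_[p]) :
    ∃ (t : ℚ_[p]) (k : GL (Fin (m + 1)) ℤ_[p]),
      ∀ j, v j = t * integralMatrix k (Fin.last m) j := by
  obtain ⟨j₀, hj₀⟩ := Finite.exists_max fun j => ‖v j‖
  rcases eq_or_ne (v j₀) 0 with h0 | h0
  · refine ⟨0, 1, fun j => ?_⟩
    have := hj₀ j
    rw [h0, norm_zero, norm_le_zero_iff] at this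
    simp [this]
  let w : Fin (m + 1) → ℤ_[p] := fun j => ⟨v j / v j₀, by
    rw [norm_div]; exact div_le_one_of_le₀ (hj₀ j) (norm_nonneg _)⟩
  have hw : w j₀ = 1 := by apply Subtype.ext; simp [w, h0]
  let σ := Equiv.swap j₀ (Fin.last m)
  let k₂ : Matrix (Fin (m + 1)) (Fin (m + 1)) ℤ_[p] :=
    (1 : Matrix _ _ _).updateRow (Fin.last m) (w ∘ σ)
  have hdet : IsUnit (k₂.submatrix id σ).det := by
    have hk₂ : k₂.det = 1 := by
      rw [Matrix.det_of_isLowerTriangular]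
      · refine Finset.prod_eq_one fun i _ => ?_
        rcases eq_or_ne i (Fin.last m) with rfl | hi
        · simp [k₂, σ, hw]
        · simp [k₂, Matrix.updateRow_ne hi]
      · intro i j hij
        have hij' : i < j := hij
        have hi : i ≠ Fin.last m := (hij'.trans_le (Fin.le_last j)).ne
        simp [k₂, Matrix.updateRow_ne hi, Matrix.one_apply_ne hij'.ne]
    rw [Matrix.det_permute', hk₂, mul_one]
    exact (Units.isUnit _).map (Int.castRingHom ℤ_[p])
  refine ⟨v j₀, Matrix.GeneralLinearGroup.mk'' _ hdet, fun j => ?_⟩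
  rw [integralMatrix_apply]
  change v j = v j₀ * (((k₂.submatrix id σ) (Fin.last m) j : ℤ_[p]) : ℚ_[p])
  have : (k₂.submatrix id σ) (Fin.last m) j = w j := by simp [k₂, σ]
  rw [this]
  change v j = v j₀ * (v j / v j₀)
  field_simp

/-- **Iwasawa decomposition** for `GL_m(ℚ_[p])`. -/
theorem exists_iwasawa {m : ℕ} (g : Matrix (Fin m) (Fin m) ℚ_[p]) (hg : g.det ≠ 0) :
    ∃ (u : Matrix (Fin m) (Fin m) ℚ_[p]) (t : Fin m → ℚ_[p]) (k : GL (Fin m) ℤ_[p]),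
      IsUnipUpper u ∧ u * g = diagonal t * integralMatrix k := by
  induction m with
  | zero => exact ⟨1, 0, 1, ⟨fun i => i.elim0, fun i => i.elim0⟩, by ext i; exact i.elim0⟩
  | succ m ih =>
    obtain ⟨d, k₀, hk₀⟩ := exists_integralMatrix_last_row (g (Fin.last m))
    let g' := g * integralMatrix k₀⁻¹
    have hk₀' : integralMatrix k₀ * integralMatrix k₀⁻¹ = 1 := by
      rw [← map_mul, mul_inv_cancel, map_one]
    have hk₀'' : integralMatrix k₀⁻¹ * integralMatrix k₀ = 1 := by
      rw [← map_mul, inv_mul_cancel, map_one]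
    have hrow : ∀ j, g' (Fin.last m) j = d * (1 : Matrix _ _ ℚ_[p]) (Fin.last m) j := fun j => by
      simp only [g', ← hk₀', Matrix.mul_apply, Finset.mul_sum]
      exact Finset.sum_congr rfl fun l _ => by rw [hk₀, mul_assoc]
    let A := g'.submatrix Fin.castSucc Fin.castSucc
    let b : Fin m → ℚ_[p] := fun i => g' i.castSucc (Fin.last m)
    have hg' : g' = bordered A b d := by
      ext i j
      induction i using Fin.lastCases <;> induction j using Fin.lastCases <;>
        simp [A, b, hrow, (Fin.castSucc_ne_last _).symm]
    have hdet : A.det * d ≠ 0 := by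
      rw [← det_bordered A b d, ← hg', Matrix.det_mul]
      refine mul_ne_zero hg fun h => ?_
      simpa [h] using norm_det_integralMatrix k₀⁻¹
    have hd : d ≠ 0 := right_ne_zero_of_mul hdet
    obtain ⟨u, t, k, hu, huk⟩ := ih A (left_ne_zero_of_mul hdet)
    have hk : IsUnit (bordered (k : Matrix (Fin m) (Fin m) ℤ_[p]) 0 1).det := by
      rw [det_bordered, mul_one]
      exact (Matrix.isUnit_iff_isUnit_det _).1 k.isUnit
    let k₁ : GL (Fin (m + 1)) ℤ_[p] := Matrix.GeneralLinearGroup.mk'' _ hk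
    have hk₁ : integralMatrix k₁ = bordered (integralMatrix k) 0 1 := by
      ext i j
      rw [integralMatrix_apply]
      change ((bordered (k : Matrix (Fin m) (Fin m) ℤ_[p]) 0 1 i j : ℤ_[p]) : ℚ_[p]) = _
      induction i using Fin.lastCases <;> induction j using Fin.lastCases <;>
        simp [integralMatrix_apply]
    have ht : diagonal (Fin.snoc (α := fun _ => ℚ_[p]) t d) = bordered (diagonal t) 0 d := by
      ext i j
      induction i using Fin.lastCases <;> induction j using Fin.lastCases <;>
        simp [Matrix.diagonal_apply, (Fin.castSucc_ne_last _).symm]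
    refine ⟨bordered u (-(d⁻¹ • (u *ᵥ b))) 1, Fin.snoc (α := fun _ => ℚ_[p]) t d, k₁ * k₀,
      hu.bordered _, ?_⟩
    have hgb : g = bordered A b d * integralMatrix k₀ := by
      rw [← hg', Matrix.mul_assoc, hk₀'', Matrix.mul_one]
    rw [map_mul, hgb, ← Matrix.mul_assoc, ← Matrix.mul_assoc, bordered_mul, hk₁, ht, bordered_mul,
      huk]
    simp [hd]

/-- An open neighbourhood of the identity contains every matrix of determinant one which is
close enough to the identity. -/
theorem exists_forall_norm_sub_one_lt_mem {m : ℕ} {K : Set (GL (Fin m) ℚ_[p])} (hK : IsOpen K)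
    (h1 : 1 ∈ K) :
    ∃ δ : ℝ, 0 < δ ∧ ∀ s : SpecialLinearGroup (Fin m) ℚ_[p],
      (∀ i j, ‖(s : Matrix (Fin m) (Fin m) ℚ_[p]) i j - (1 : Matrix _ _ _) i j‖ < δ) →
        (s : GL (Fin m) ℚ_[p]) ∈ K := by
  have hopen : IsOpen {s : SpecialLinearGroup (Fin m) ℚ_[p] | (s : GL (Fin m) ℚ_[p]) ∈ K} :=
    hK.preimage SpecialLinearGroup.continuous_toGL
  obtain ⟨V, hV, hVK⟩ :=
    SpecialLinearGroup.isClosedEmbedding_val.isInducing.isOpen_iff.1 hopen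
  have h1V : (1 : SpecialLinearGroup (Fin m) ℚ_[p]) ∈
      ((↑) : SpecialLinearGroup (Fin m) ℚ_[p] → Matrix (Fin m) (Fin m) ℚ_[p]) ⁻¹' V := by
    rw [hVK]
    change SpecialLinearGroup.toGL 1 ∈ K
    rwa [map_one]
  have hV' : IsOpen (X := Fin m → Fin m → ℚ_[p]) V := hV
  obtain ⟨δ, hδ, hball⟩ := Metric.isOpen_iff.1 hV' (1 : Matrix (Fin m) (Fin m) ℚ_[p]) h1V
  refine ⟨δ, hδ, fun s hs => ?_⟩
  have hsV : s ∈ ((↑) : SpecialLinearGroup (Fin m) ℚ_[p] → Matrix (Fin m) (Fin m) ℚ_[p]) ⁻¹' V := by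
    refine hball ((dist_pi_lt_iff hδ).2 fun i => (dist_pi_lt_iff hδ).2 fun j => ?_)
    rw [dist_eq_norm]
    exact hs i j
  rwa [hVK] at hsV

theorem isCompact_closure_of_norm_le {m : ℕ} {S : Set (GL (Fin m) ℚ_[p])} {B : ℝ}
    (hdet : ∀ g ∈ S, (g : Matrix (Fin m) (Fin m) ℚ_[p]).det = 1)
    (hB : ∀ g ∈ S, ∀ i j, ‖(g : Matrix (Fin m) (Fin m) ℚ_[p]) i j‖ ≤ B) :
    IsCompact (closure S) := by
  have hc' : IsCompact {A : Fin m → Fin m → ℚ_[p] | ∀ i j, ‖A i j‖ ≤ B} := by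
    have h := isCompact_univ_pi fun _ : Fin m =>
      isCompact_univ_pi fun _ : Fin m => isCompact_closedBall (0 : ℚ_[p]) B
    convert h using 1
    ext A
    simp [Set.mem_pi]
  have hc : IsCompact {A : Matrix (Fin m) (Fin m) ℚ_[p] | ∀ i j, ‖A i j‖ ≤ B} := hc'
  refine ((SpecialLinearGroup.isClosedEmbedding_val.isCompact_preimage hc).image
    SpecialLinearGroup.continuous_toGL).closure_of_subset fun g hg => ?_
  exact ⟨⟨g, hdet g hg⟩, hB g hg, Units.ext rfl⟩

theorem sdSumUpTo_one_add_single {R : Type*} [Ring R] {m : ℕ} (i : ℕ) (hi : i + 1 < m) (a : R) :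
    sdSumUpTo m (m - 1) (1 + Matrix.single ⟨i, by omega⟩ ⟨i + 1, hi⟩ a) = a := by
  rw [sdSumUpTo, Finset.sum_eq_single ⟨i, by omega⟩]
  · simp [hi]
  · intro j _ hj
    have : i ≠ j := fun h => hj (Fin.ext h.symm)
    simp [this]
  · simp

theorem isUnipUpper_one_add_single {R : Type*} [Ring R] {m : ℕ} {i j : Fin m} (hij : i < j)
    (a : R) : IsUnipUpper (1 + Matrix.single i j a) := by
  refine ⟨fun k l h => ?_, fun k => ?_⟩
  · have h1 : k ≠ l := fun e => by simp [e] at h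
    have h2 : ¬(i = k ∧ j = l) := by rintro ⟨rfl, rfl⟩; exact absurd h (not_lt.2 hij.le)
    simp [h1, h2]
  · have h2 : ¬(i = k ∧ j = k) := by rintro ⟨rfl, h⟩; exact hij.ne' h
    simp [h2]

theorem IsUnipUpper.det_eq_one {R : Type*} [CommRing R] {m : ℕ} {u : Matrix (Fin m) (Fin m) R}
    (hu : IsUnipUpper u) : u.det = 1 := by
  rw [Matrix.det_of_isUpperTriangular fun i j h => hu.1 i j h]
  exact Finset.prod_eq_one fun i _ => hu.2 i

/-- On elements `t k` with `t` diagonal and `k` integral, a Whittaker function which is invariant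
on the right under an open subgroup vanishes unless the ratios `t_i / t_{i+1}` are bounded. -/
theorem exists_norm_diagonal_le_of_whittaker {m : ℕ} {ψ : ℚ_[p] → ℂˣ} (hψ : ∃ a, ψ a ≠ 1)
    {W : GL (Fin m) ℚ_[p] → ℂ} {K : Subgroup (GL (Fin m) ℚ_[p])}
    (hK : IsOpen (K : Set (GL (Fin m) ℚ_[p]))) (hWK : ∀ g, ∀ k ∈ K, W (g * k) = W g)
    (hW : ∀ u g : GL (Fin m) ℚ_[p], IsUnipUpper (u : Matrix (Fin m) (Fin m) ℚ_[p]) →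
      W (u * g) = (ψ (sdSumUpTo m (m - 1) (u : Matrix (Fin m) (Fin m) ℚ_[p])) : ℂ) * W g) :
    ∃ C : ℝ, 1 ≤ C ∧ ∀ (g : GL (Fin m) ℚ_[p]) (t : Fin m → ℚ_[p]) (k : GL (Fin m) ℤ_[p]),
      (g : Matrix (Fin m) (Fin m) ℚ_[p]) = diagonal t * integralMatrix k → W g ≠ 0 →
        ∀ (i : ℕ) (hi : i + 1 < m), ‖t ⟨i, by omega⟩‖ ≤ C * ‖t ⟨i + 1, hi⟩‖ := by
  obtain ⟨a, ha⟩ := hψ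
  obtain ⟨δ, hδ, hδK⟩ := exists_forall_norm_sub_one_lt_mem hK K.one_mem
  refine ⟨max 1 (‖a‖ / δ), le_max_left _ _, fun g t k hg hWg i hi => ?_⟩
  by_contra! hlt
  set i₀ : Fin m := ⟨i, by omega⟩
  set i₁ : Fin m := ⟨i + 1, hi⟩
  have hi₀₁ : i₀ < i₁ := Nat.lt_succ_self i
  have hlt' : ‖a‖ / δ * ‖t i₁‖ < ‖t i₀‖ :=
    (mul_le_mul_of_nonneg_right (le_max_right _ _) (norm_nonneg _)).trans_lt hlt
  have ht : 0 < ‖t i₀‖ := lt_of_le_of_lt (by positivity) hlt'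
  have ht0 : t i₀ ≠ 0 := norm_pos_iff.1 ht
  set y := a * t i₁ / t i₀
  have hy : ‖y‖ < δ := by
    rw [norm_div, norm_mul, div_lt_iff₀ ht]
    rwa [div_mul_eq_mul_div, div_lt_iff₀ hδ, mul_comm _ δ] at hlt'
  have hkk : integralMatrix k * integralMatrix k⁻¹ = 1 := by
    rw [← map_mul, mul_inv_cancel, map_one]
  have hkk' : integralMatrix k⁻¹ * integralMatrix k = 1 := by
    rw [← map_mul, inv_mul_cancel, map_one]
  let s : SpecialLinearGroup (Fin m) ℚ_[p] :=
    ⟨integralMatrix k⁻¹ * (1 + single i₀ i₁ y) * integralMatrix k, by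
      rw [det_mul, det_mul, (isUnipUpper_one_add_single hi₀₁ y).det_eq_one, mul_one, ← det_mul,
        hkk', det_one]⟩
  let v : SpecialLinearGroup (Fin m) ℚ_[p] :=
    ⟨1 + single i₀ i₁ a, (isUnipUpper_one_add_single hi₀₁ a).det_eq_one⟩
  have hs : (s : GL (Fin m) ℚ_[p]) ∈ K := hδK s fun b c => by
    have e : (s : Matrix (Fin m) (Fin m) ℚ_[p]) - 1
        = integralMatrix k⁻¹ * single i₀ i₁ y * integralMatrix k := by
      change integralMatrix k⁻¹ * (1 + single i₀ i₁ y) * integralMatrix k - 1 = _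
      rw [mul_add, add_mul, mul_one, hkk', add_sub_cancel_left]
    have e' : (integralMatrix k⁻¹ * single i₀ i₁ y * integralMatrix k) b c
        = integralMatrix k⁻¹ b i₀ * y * integralMatrix k i₁ c := by
      rw [Matrix.mul_apply, Finset.sum_eq_single i₁]
      · simp
      · intro l _ hl
        simp [hl]
      · simp
    rw [← Matrix.sub_apply, e, e', norm_mul, norm_mul]
    refine lt_of_le_of_lt ?_ hy
    calc _ ≤ 1 * ‖y‖ * 1 := by
          gcongr <;> exact norm_integralMatrix_le _ _ _
      _ = ‖y‖ := by ring
  have hcomm : g * (s : GL (Fin m) ℚ_[p]) = (v : GL (Fin m) ℚ_[p]) * g := by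
    apply Units.ext
    change (g : Matrix (Fin m) (Fin m) ℚ_[p])
        * (integralMatrix k⁻¹ * (1 + single i₀ i₁ y) * integralMatrix k)
      = (1 + single i₀ i₁ a) * (g : Matrix (Fin m) (Fin m) ℚ_[p])
    have e : diagonal t * single i₀ i₁ y = single i₀ i₁ a * diagonal t := by
      ext b c
      rw [diagonal_mul, mul_diagonal]
      by_cases h : i₀ = b ∧ i₁ = c
      · obtain ⟨rfl, rfl⟩ := h
        simp only [single_apply_same, y]
        field_simp
      · simp [h]
    calc _ = diagonal t * (integralMatrix k * integralMatrix k⁻¹) * (1 + single i₀ i₁ y)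
          * integralMatrix k := by rw [hg]; simp only [Matrix.mul_assoc]
      _ = _ := by
          rw [hkk, Matrix.mul_one, mul_add, e, hg, Matrix.mul_one, ← Matrix.mul_assoc,
            add_mul, add_mul, Matrix.one_mul, add_mul]
  have h := hWK g s hs
  rw [hcomm, hW v g (isUnipUpper_one_add_single hi₀₁ a)] at h
  have hsd : sdSumUpTo m (m - 1)
      ((v : GL (Fin m) ℚ_[p]) : Matrix (Fin m) (Fin m) ℚ_[p]) = a :=
    sdSumUpTo_one_add_single i hi a
  rw [hsd] at h
  exact ha (Units.ext (mul_right_cancel₀ hWg (h.trans (one_mul _).symm)))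

/-- If `1 ≤ |t_1|`, `|t_i| ≤ C |t_{i+1}|` and `∏ |t_i| = 1`, then all `|t_i|` are bounded above. -/
theorem le_pow_of_prod_eq_one {m : ℕ} {C : ℝ} (hC : 1 ≤ C) {t : Fin m → ℝ}
    (h0 : ∀ i : Fin m, (i : ℕ) = 0 → 1 ≤ t i)
    (hstep : ∀ (i : ℕ) (hi : i + 1 < m), t ⟨i, by omega⟩ ≤ C * t ⟨i + 1, hi⟩)
    (hprod : ∏ i, t i = 1) (i : Fin m) : t i ≤ (C ^ m) ^ m := by
  have hlow : ∀ (j : ℕ) (hj : j < m), 1 ≤ C ^ j * t ⟨j, hj⟩ := by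
    intro j
    induction j with
    | zero => intro hj; simpa using h0 ⟨0, hj⟩ rfl
    | succ j ih =>
      intro hj
      calc 1 ≤ C ^ j * t ⟨j, by omega⟩ := ih _
        _ ≤ C ^ j * (C * t ⟨j + 1, hj⟩) := by gcongr; exact hstep j hj
        _ = _ := by ring
  have hpos : ∀ j : Fin m, 0 < t j := fun j =>
    pos_of_mul_pos_right (one_pos.trans_le (hlow j j.2)) (by positivity)
  have hlow' : ∀ j : Fin m, 1 ≤ C ^ m * t j := fun j =>
    (hlow j j.2).trans (by have := hpos j; gcongr; exact j.2.le)
  calc t i ≤ C ^ m * t i := le_mul_of_one_le_left (hpos i).le (one_le_pow₀ hC)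
    _ ≤ ∏ j, C ^ m * t j := by
      rw [← Finset.mul_prod_erase _ _ (Finset.mem_univ i)]
      refine le_mul_of_one_le_right (zero_le_one.trans (hlow' i)) ?_
      simpa using Finset.prod_le_prod (s := Finset.univ.erase i) (f := fun _ => (1 : ℝ))
        (fun _ _ => zero_le_one) fun j _ => hlow' j
    _ = (C ^ m) ^ m := by simp [Finset.prod_mul_distrib, hprod]

/-- A smooth Whittaker function on `GL_m(ℚ_[p])` has bounded support on the lower unipotent
matrices whose first column is that of the identity. -/
theorem exists_norm_le_of_whittaker {m : ℕ} {ψ : ℚ_[p] → ℂˣ} (hψ : ∃ a, ψ a ≠ 1)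
    {W : GL (Fin m) ℚ_[p] → ℂ} {K : Subgroup (GL (Fin m) ℚ_[p])}
    (hK : IsOpen (K : Set (GL (Fin m) ℚ_[p]))) (hWK : ∀ g, ∀ k ∈ K, W (g * k) = W g)
    (hW : ∀ u g : GL (Fin m) ℚ_[p], IsUnipUpper (u : Matrix (Fin m) (Fin m) ℚ_[p]) →
      W (u * g) = (ψ (sdSumUpTo m (m - 1) (u : Matrix (Fin m) (Fin m) ℚ_[p])) : ℂ) * W g) :
    ∃ B : ℝ, ∀ g : GL (Fin m) ℚ_[p], IsUnipUpper (g : Matrix (Fin m) (Fin m) ℚ_[p])ᵀ →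
      (∀ i j : Fin m, (j : ℕ) = 0 → i ≠ j → (g : Matrix (Fin m) (Fin m) ℚ_[p]) i j = 0) →
      W g ≠ 0 → ∀ i j, ‖(g : Matrix (Fin m) (Fin m) ℚ_[p]) i j‖ ≤ B := by
  obtain ⟨C, hC, hstep⟩ := exists_norm_diagonal_le_of_whittaker hψ hK hWK hW
  obtain ⟨B, hB⟩ := exists_norm_le_of_unipUpper_mul (R := ℚ_[p]) m ((C ^ m) ^ m)
  refine ⟨B, fun g hg hcol hWg => ?_⟩
  have hdet : (g : Matrix (Fin m) (Fin m) ℚ_[p]).det = 1 := by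
    rw [← det_transpose, hg.det_eq_one]
  obtain ⟨u, t, k, hu, huk⟩ := exists_iwasawa (g : Matrix (Fin m) (Fin m) ℚ_[p]) (by simp [hdet])
  let v : SpecialLinearGroup (Fin m) ℚ_[p] := ⟨u, hu.det_eq_one⟩
  have hWv : W ((v : GL (Fin m) ℚ_[p]) * g) ≠ 0 := by
    rw [hW v g hu]
    exact mul_ne_zero (Units.ne_zero _) hWg
  have hprod : ∏ i, ‖t i‖ = 1 := by
    have h := congrArg (fun A => ‖det A‖) huk
    simp only [det_mul, det_diagonal, norm_mul, norm_det_integralMatrix, hdet, hu.det_eq_one] at h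
    simpa using h.symm
  have h0 : ∀ i : Fin m, (i : ℕ) = 0 → 1 ≤ ‖t i‖ := fun i hi => by
    have h := congrFun (congrFun huk i) i
    rw [Matrix.mul_apply, Finset.sum_eq_single i
      (fun l _ hl => by rw [hcol l i hi hl, mul_zero]) (by simp), hu.2, one_mul,
      diagonal_mul] at h
    have hgi : (g : Matrix (Fin m) (Fin m) ℚ_[p]) i i = 1 := hg.2 i
    have h' := congrArg norm h
    rw [hgi, norm_one, norm_mul] at h'
    rw [h']
    exact mul_le_of_le_one_right (norm_nonneg _) (norm_integralMatrix_le _ _ _)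
  refine hB u g hu hg fun i j => ?_
  rw [huk, diagonal_mul, norm_mul]
  exact (mul_le_of_le_one_right (norm_nonneg _) (norm_integralMatrix_le _ _ _)).trans
    (le_pow_of_prod_eq_one hC h0 (hstep _ t k huk hWv) hprod i)

theorem isUnipUpper_transpose_of_mem_VrM {n : ℕ} {M : Matrix (Fin (2 * n)) (Fin (2 * n)) ℚ_[p]}
    (hM : M ∈ VrM p n) : IsUnipUpper Mᵀ := by
  obtain ⟨X, u, -, hu, rfl⟩ := hM
  refine ⟨fun i j h => ?_, fun i => ?_⟩
  · obtain ⟨i, rfl⟩ := (sumEquiv n).surjective i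
    obtain ⟨j, rfl⟩ := (sumEquiv n).surjective j
    rcases i with i | i <;> rcases j with j | j
    · have hij : j ≠ i := fun e => by simp [e] at h
      simp [blk, Matrix.one_apply_ne hij]
    · simp [sumEquiv] at h
      omega
    · simp [blk]
    · have hij : (j : ℕ) < i := by simpa [sumEquiv] using h
      simpa [blk] using hu.1 i j hij
  · obtain ⟨i, rfl⟩ := (sumEquiv n).surjective i
    rcases i with i | i
    · simp [blk]
    · simpa [blk] using hu.2 i

theorem apply_eq_zero_of_mem_VrM {n : ℕ} {M : Matrix (Fin (2 * n)) (Fin (2 * n)) ℚ_[p]}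
    (hM : M ∈ VrM p n) {i j : Fin (2 * n)} (hj : (j : ℕ) = 0) (hij : i ≠ j) : M i j = 0 := by
  obtain ⟨X, u, hX, -, rfl⟩ := hM
  obtain ⟨i, rfl⟩ := (sumEquiv n).surjective i
  obtain ⟨j, rfl⟩ := (sumEquiv n).surjective j
  rcases j with j | j
  · rcases i with i | i
    · have : i ≠ j := fun e => hij (by rw [e])
      simp [blk, Matrix.one_apply_ne this]
    · simpa [blk] using hX i j (by simpa [sumEquiv] using hj)
  · have := j.2
    simp [sumEquiv] at hj
    omega

end Padic

/-- **Compact support of Whittaker-type functions on the subgroup `V_r`** (established in the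
proof of Proposition 6.5).  A smooth continuous function on `GL_{2n}(ℚ_p)` which is
`(N_{2n}, ψ_{N_{2n}})`-equivariant on the left has compactly supported restriction to `V_r`. -/
theorem whittaker_compact_support_on_Vr
    (p : ℕ) [Fact p.Prime] (n : ℕ) (hn : 1 ≤ n)
    (ψ : ℚ_[p] → ℂˣ)
    (hψ_add : ∀ a b : ℚ_[p], ψ (a + b) = ψ a * ψ b)
    (hψ_cont : Continuous ψ)
    (hψ_ne : ∃ a : ℚ_[p], ψ a ≠ 1)
    (W : GL (Fin (2 * n)) ℚ_[p] → ℂ)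
    (hW_cont : Continuous W)
    (hW_smooth : ∃ K₀ : Subgroup (GL (Fin (2 * n)) ℚ_[p]),
      IsCompact (K₀ : Set (GL (Fin (2 * n)) ℚ_[p])) ∧
      IsOpen (K₀ : Set (GL (Fin (2 * n)) ℚ_[p])) ∧
      ∀ g : GL (Fin (2 * n)) ℚ_[p], ∀ k ∈ K₀, W (g * k) = W g)
    (hW_equiv : ∀ u g : GL (Fin (2 * n)) ℚ_[p],
      IsUnipUpper (u : Matrix (Fin (2 * n)) (Fin (2 * n)) ℚ_[p]) →
      W (u * g) =
        (ψ (sdSumUpTo (2 * n) (2 * n - 1)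
          (u : Matrix (Fin (2 * n)) (Fin (2 * n)) ℚ_[p])) : ℂ) * W g) :
    IsCompact (closure {r : GL (Fin (2 * n)) ℚ_[p] |
      (r : Matrix (Fin (2 * n)) (Fin (2 * n)) ℚ_[p]) ∈ VrM p n ∧ W r ≠ 0}) := by
  obtain ⟨K₀, -, hK₀, hWK₀⟩ := hW_smooth
  obtain ⟨B, hB⟩ := exists_norm_le_of_whittaker hψ_ne hK₀ hWK₀ hW_equiv
  refine isCompact_closure_of_norm_le (B := B) (fun g hg => ?_) fun g hg =>
    hB g (isUnipUpper_transpose_of_mem_VrM hg.1)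
      (fun _ _ hj hij => apply_eq_zero_of_mem_VrM hg.1 hj hij) hg.2
  rw [← det_transpose, (isUnipUpper_transpose_of_mem_VrM hg.1).det_eq_one]
end

section
/- (Boundedness of the torus support of smooth ψ-equivariant functions; support property used in the proofs of Lemma 5.3 and Proposition 6.5.) Let m ≥ 2 and let K₀ be a compact open subgroup of GL_m(ℚ_p). Then there exists a constant C > 0, depending only on K₀ and ψ, such that for every function W : GL_m(ℚ_p) → ℂ satisfying W(u·g) = ψ_{N_m}(u)·W(g) for all u ∈ N_m, g ∈ GL_m(ℚ_p), and W(g·k) = W(g) for all g ∈ GL_m(ℚ_p), k ∈ K₀, and for every invertible diagonal matrix t = diag(t_1, …, t_m) with W(t) ≠ 0, one has |t_i · t_{i+1}^{-1}|_p ≤ C for all 1 ≤ i ≤ m−1. -/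
open scoped MatrixGroups
open Matrix

/-- The elementary matrix `1 + x E_{i,j}`, `i ≠ j`, as an element of the general linear group. -/
def transvectionGL {n R : Type*} [Fintype n] [DecidableEq n] [CommRing R] {i j : n}
    (hij : i ≠ j) (x : R) : GL n R where
  val := transvection i j x
  inv := transvection i j (-x)
  val_inv := by rw [transvection_mul_transvection_same _ _ hij, add_neg_cancel, transvection_zero]
  inv_val := by rw [transvection_mul_transvection_same _ _ hij, neg_add_cancel, transvection_zero]

theorem coe_transvectionGL {n R : Type*} [Fintype n] [DecidableEq n] [CommRing R] {i j : n}
    (hij : i ≠ j) (x : R) : (transvectionGL hij x : Matrix n n R) = transvection i j x := rfl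

theorem transvectionGL_zero {n R : Type*} [Fintype n] [DecidableEq n] [CommRing R] {i j : n}
    (hij : i ≠ j) : transvectionGL hij (0 : R) = 1 :=
  Units.ext (transvection_zero i j)

theorem continuous_transvectionGL {n R : Type*} [Fintype n] [DecidableEq n] [CommRing R]
    [TopologicalSpace R] [IsTopologicalRing R] {i j : n} (hij : i ≠ j) :
    Continuous (transvectionGL hij : R → GL n R) := by
  have h : Continuous fun x : R => transvection i j x :=
    continuous_const.add <| continuous_matrix fun k l => by
      simp only [single_apply]
      split_ifs
      exacts [continuous_id, continuous_const]
  exact Units.continuous_iff.2 ⟨h, h.comp continuous_neg⟩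

theorem Matrix.IsDiag.mul_transvection {n R : Type*} [Fintype n] [DecidableEq n] [CommRing R]
    {t : Matrix n n R} (ht : t.IsDiag) (i j : n) {x y : R} (h : t i i * y = x * t j j) :
    t * transvection i j y = transvection i j x * t := by
  obtain ⟨d, rfl⟩ : ∃ d, t = diagonal d := ⟨_, ((isDiag_iff_diagonal_diag t).1 ht).symm⟩
  simp only [diagonal_apply_eq] at h
  simp only [transvection, mul_add, add_mul, mul_one, one_mul, add_right_inj]
  ext k l
  rw [diagonal_mul, mul_diagonal, single_apply, single_apply]
  split_ifs with hkl
  · rw [← hkl.1, ← hkl.2, h]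
  · simp

theorem isUnipUpper_transvection {R : Type*} [CommRing R] {m : ℕ} {i j : Fin m} (hij : i < j)
    (x : R) : IsUnipUpper (transvection i j x) := by
  refine ⟨fun k l hkl => ?_, fun k => ?_⟩
  · have hne : k ≠ l := by rintro rfl; exact lt_irrefl _ hkl
    have hlt : ¬(i = k ∧ j = l) := by rintro ⟨rfl, rfl⟩; exact lt_asymm hij hkl
    simp [transvection, one_apply_ne hne, hlt]
  · have hlt : ¬(i = k ∧ j = k) := by rintro ⟨rfl, rfl⟩; exact lt_irrefl _ hij
    simp [transvection, hlt]

theorem sdSumUpTo_transvection {R : Type*} [CommRing R] {m : ℕ} (i : Fin m)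
    (h : (i : ℕ) + 1 < m) (x : R) :
    sdSumUpTo m (m - 1) (transvection i ⟨(i : ℕ) + 1, h⟩ x) = x := by
  unfold sdSumUpTo
  rw [Finset.sum_eq_single ⟨(i : ℕ), by omega⟩]
  · simp [h, transvection, one_apply, Fin.ext_iff]
  · intro k _ hk
    have hk' : (i : ℕ) ≠ k := fun e => hk (Fin.ext e.symm)
    simp [transvection, one_apply, Fin.ext_iff, hk']
  · simp

/-- **Boundedness of the torus support of smooth `ψ`-equivariant functions** (used in the proofs
of Lemma 5.3 and Proposition 6.5).  Given a compact open subgroup `K₀` of `GL_m(ℚ_p)` there is a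
constant `C > 0`, depending only on `K₀` and `ψ`, such that every left
`(N_m, ψ_{N_m})`-equivariant, right-`K₀`-invariant function `W` satisfies:
if `t` is an invertible diagonal matrix with `W t ≠ 0`, then `|tᵢ tᵢ₊₁⁻¹|_p ≤ C` for all `i`. -/
theorem torus_support_bounded
    (p : ℕ) [Fact p.Prime] (m : ℕ) (hm : 2 ≤ m)
    (ψ : ℚ_[p] → ℂˣ)
    (hψ_add : ∀ a b : ℚ_[p], ψ (a + b) = ψ a * ψ b)
    (hψ_cont : Continuous ψ)
    (hψ_ne : ∃ a : ℚ_[p], ψ a ≠ 1)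
    (K₀ : Subgroup (GL (Fin m) ℚ_[p]))
    (hK₀_cpt : IsCompact (K₀ : Set (GL (Fin m) ℚ_[p])))
    (hK₀_open : IsOpen (K₀ : Set (GL (Fin m) ℚ_[p]))) :
    ∃ C : ℝ, 0 < C ∧
      ∀ W : GL (Fin m) ℚ_[p] → ℂ,
        (∀ u g : GL (Fin m) ℚ_[p],
          IsUnipUpper (u : Matrix (Fin m) (Fin m) ℚ_[p]) →
          W (u * g) =
            (ψ (sdSumUpTo m (m - 1) (u : Matrix (Fin m) (Fin m) ℚ_[p])) : ℂ) * W g) →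
        (∀ g : GL (Fin m) ℚ_[p], ∀ k ∈ K₀, W (g * k) = W g) →
        ∀ t : GL (Fin m) ℚ_[p],
          (∀ i j : Fin m, i ≠ j → (t : Matrix (Fin m) (Fin m) ℚ_[p]) i j = 0) →
          W t ≠ 0 →
          ∀ i : Fin m, ∀ h : (i : ℕ) + 1 < m,
            ‖(t : Matrix (Fin m) (Fin m) ℚ_[p]) i i /
              (t : Matrix (Fin m) (Fin m) ℚ_[p]) ⟨(i : ℕ) + 1, h⟩ ⟨(i : ℕ) + 1, h⟩‖ ≤ C := by
  obtain ⟨a, ha⟩ := hψ_ne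
  have hψ0 : ψ 0 = 1 := by simpa using hψ_add 0 0
  have ha0 : a ≠ 0 := by rintro rfl; exact ha hψ0
  have hne (i : Fin m) (h : (i : ℕ) + 1 < m) : i ≠ ⟨(i : ℕ) + 1, h⟩ := by
    simp [Fin.ext_iff]
  have hev : ∀ᶠ x : ℚ_[p] in nhds 0, ∀ (i : Fin m) (h : (i : ℕ) + 1 < m),
      transvectionGL (hne i h) x ∈ K₀ := by
    refine Filter.eventually_all.2 fun i => Filter.eventually_all.2 fun h => ?_
    refine (continuous_transvectionGL (hne i h)).continuousAt.eventually
      (hK₀_open.mem_nhds ?_)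
    rw [transvectionGL_zero]
    exact K₀.one_mem
  obtain ⟨r, hr, hball⟩ := Metric.eventually_nhds_iff.1 hev
  refine ⟨‖a‖ / r, div_pos (norm_pos_iff.2 ha0) hr, fun W hWN hWK t ht hWt i h => ?_⟩
  by_contra! hlt
  set j : Fin m := ⟨(i : ℕ) + 1, h⟩
  set q := (t : Matrix (Fin m) (Fin m) ℚ_[p]) i i / (t : Matrix (Fin m) (Fin m) ℚ_[p]) j j with hq
  have hqpos : 0 < ‖q‖ := (by positivity : 0 ≤ ‖a‖ / r).trans_lt hlt
  obtain ⟨hti, htj⟩ := div_ne_zero_iff.1 (norm_pos_iff.1 hqpos)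
  have hk : transvectionGL (hne i h) (a / q) ∈ K₀ := by
    refine hball ?_ i h
    rw [dist_zero_right, norm_div]
    exact (div_lt_comm₀ hr hqpos).1 hlt
  have hcomm : t * transvectionGL (hne i h) (a / q) = transvectionGL (hne i h) a * t := by
    refine Units.ext (IsDiag.mul_transvection (fun k l => ht k l) i j ?_)
    rw [hq]
    field_simp
  have hW := hWK t _ hk
  rw [hcomm, hWN _ _ (isUnipUpper_transvection (Nat.lt_succ_self _) a), coe_transvectionGL,
    sdSumUpTo_transvection] at hW
  exact ha (Units.ext (mul_right_cancel₀ hWt (hW.trans (one_mul _).symm)))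
end

section
/- (Lemma A.2, stated for GL_m(ℚ_p).) Let m ≥ 2 and let n ≥ 1 be large enough that every element of 1 + p^nℤ_p is an m-th power in ℚ_pˣ (equivalently, the continuous homomorphism A_n → (1 + p^nℤ_p)^{m−1}, t ↦ (t_1 t_2^{-1}, …, t_{m−1} t_m^{-1}), is surjective). Then for every u ∈ N_m one has ∫_{A_n} ψ_{N_m}(t·u·t^{-1}) dμ_n(t) = ψ_{N_m}(u) if u ∈ N_m(n), and = 0 otherwise. -/
open MeasureTheory Matrix

noncomputable instance (p : ℕ) [Fact p.Prime] : MeasurableSpace ℚ_[p] := borel _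
instance (p : ℕ) [Fact p.Prime] : BorelSpace ℚ_[p] := ⟨rfl⟩

/-- The compact group `A_n`, described through the `m`-tuples of diagonal entries:
`t₁ ⋯ t_m = 1` and `tᵢ tᵢ₊₁⁻¹ ∈ 1 + pⁿℤ_p` for all `i`. -/
def AnSet (p : ℕ) [Fact p.Prime] (m n : ℕ) : Set (Fin m → ℚ_[p]) :=
  {t | (∏ i, t i) = 1 ∧
    ∀ i : Fin m, ∀ h : (i : ℕ) + 1 < m,
      ‖t i / t ⟨(i : ℕ) + 1, h⟩ - 1‖ ≤ (p : ℝ) ^ (-(n : ℤ))}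

/-- The superdiagonal sum of the conjugate of `u` by an invertible diagonal matrix. -/
lemma sdSumUpTo_diagonal_conj {K : Type*} [Field K] {m : ℕ} (t : Fin m → K)
    (ht : ∀ i, t i ≠ 0) (u : Matrix (Fin m) (Fin m) K) :
    sdSumUpTo m (m - 1) (Matrix.diagonal t * u * (Matrix.diagonal t)⁻¹) =
      ∑ i : Fin (m - 1), t ⟨i, by omega⟩ / t ⟨(i : ℕ) + 1, by omega⟩ *
        u ⟨i, by omega⟩ ⟨(i : ℕ) + 1, by omega⟩ := by
  have hinv : (Matrix.diagonal t)⁻¹ = Matrix.diagonal (fun i => (t i)⁻¹) := by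
    apply Matrix.inv_eq_right_inv
    rw [Matrix.diagonal_mul_diagonal, ← Matrix.diagonal_one]
    congr 1
    funext i
    exact mul_inv_cancel₀ (ht i)
  unfold sdSumUpTo
  refine Finset.sum_congr rfl fun i _ => ?_
  rw [dif_pos (by omega), hinv, Matrix.mul_diagonal, Matrix.diagonal_mul]
  ring

lemma sdSumUpTo_pred {R : Type*} [AddCommMonoid R] {m : ℕ} (u : Matrix (Fin m) (Fin m) R) :
    sdSumUpTo m (m - 1) u =
      ∑ i : Fin (m - 1), u ⟨i, by omega⟩ ⟨(i : ℕ) + 1, by omega⟩ :=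
  Finset.sum_congr rfl fun i _ => dif_pos (by omega)

lemma ne_zero_of_mem_AnSet {p : ℕ} [Fact p.Prime] {m n : ℕ} {t : Fin m → ℚ_[p]}
    (ht : t ∈ AnSet p m n) (i : Fin m) : t i ≠ 0 := by
  have h : ∏ i, t i ≠ 0 := by rw [ht.1]; exact one_ne_zero
  exact Finset.prod_ne_zero_iff.mp h i (Finset.mem_univ i)

/-- An additive-to-multiplicative map trivial on the unit ball is constant on its cosets. -/
lemma eq_of_norm_sub_le_one {p : ℕ} [Fact p.Prime] {ψ : ℚ_[p] → ℂˣ}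
    (hψ_add : ∀ a b : ℚ_[p], ψ (a + b) = ψ a * ψ b)
    (hψ_triv : ∀ x : ℚ_[p], ‖x‖ ≤ 1 → ψ x = 1) {a b : ℚ_[p]} (h : ‖a - b‖ ≤ 1) :
    ψ a = ψ b := by
  rw [← sub_add_cancel a b, hψ_add, hψ_triv _ h, one_mul]

/-- If `a` has an `m`-th root, there is an element of `A_n` whose `k`-th simple root equals `a`
and whose other simple roots equal `1`. -/
lemma exists_mem_AnSet {p : ℕ} [Fact p.Prime] {m n : ℕ} {a : ℚ_[p]} (ha0 : a ≠ 0)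
    (ha : ‖a - 1‖ ≤ (p : ℝ) ^ (-(n : ℤ))) (hroot : ∃ y : ℚ_[p], y ^ m = a)
    (k : ℕ) (hk : k + 1 < m) :
    ∃ s ∈ AnSet p m n, ∀ i : Fin m, ∀ h : (i : ℕ) + 1 < m,
      s i / s ⟨(i : ℕ) + 1, h⟩ = if (i : ℕ) = k then a else 1 := by
  obtain ⟨y, hy⟩ := hroot
  have hy0 : y ≠ 0 := by
    rintro rfl
    rw [zero_pow (by omega)] at hy
    exact ha0 hy.symm
  set b : ℚ_[p] := (y ^ (k + 1))⁻¹ with hb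
  have hb0 : b ≠ 0 := inv_ne_zero (pow_ne_zero _ hy0)
  have hquot : ∀ i : ℕ, (if i ≤ k then a else 1) * b / ((if i + 1 ≤ k then a else 1) * b) =
      if i = k then a else 1 := by
    intro i
    rw [mul_div_mul_right _ _ hb0]
    split_ifs <;> first | omega | simp [ha0]
  refine ⟨fun i => (if (i : ℕ) ≤ k then a else 1) * b, ⟨?_, fun i h => ?_⟩, fun i _ => hquot i⟩
  · have hcard : (Finset.univ.filter fun i : Fin m => (i : ℕ) ≤ k).card = k + 1 := by
      have : (Finset.univ.filter fun i : Fin m => (i : ℕ) ≤ k) = Finset.Iic ⟨k, by omega⟩ := by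
        ext i
        simp [Fin.le_def]
      rw [this, Fin.card_Iic]
    rw [Finset.prod_mul_distrib, Finset.prod_ite, Finset.prod_const, Finset.prod_const_one,
      mul_one, Finset.prod_const, hcard, Finset.card_univ, Fintype.card_fin, hb, ← hy, inv_pow,
      ← pow_mul, ← pow_mul, mul_comm m]
    exact mul_inv_cancel₀ (pow_ne_zero _ hy0)
  · simp only [hquot]
    split_ifs
    · exact ha
    · simp only [sub_self, norm_zero]
      positivity

/-- Left multiplication by a vector with nonzero entries is a measurable embedding. -/
lemma measurableEmbedding_mul_left_pi {p : ℕ} [Fact p.Prime] {m : ℕ} {s : Fin m → ℚ_[p]}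
    (hs : ∀ i, s i ≠ 0) : MeasurableEmbedding (fun t : Fin m → ℚ_[p] => s * t) :=
  (MeasurableEquiv.piCongrRight fun i => MeasurableEquiv.mulLeft₀ (s i) (hs i)).measurableEmbedding

/-- **Lemma A.2 for `GL_m(ℚ_p)`.**  Let `ψ` be trivial on `ℤ_p` and nontrivial on `p⁻¹ℤ_p`, and
let `n ≥ 1` be large enough that every element of `1 + pⁿℤ_p` is an `m`-th power in `ℚ_pˣ`.
If `μₙ` is the Haar probability measure of the compact group `Aₙ` (encoded as an `Aₙ`-invariant
probability measure concentrated on `Aₙ`), then for every `u ∈ N_m`,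
`∫_{Aₙ} ψ_{N_m}(t u t⁻¹) dμₙ(t)` equals `ψ_{N_m}(u)` if `u ∈ N_m(n)`, and `0` otherwise. -/
theorem lemma_A_2
    (p : ℕ) [Fact p.Prime] (m n : ℕ) (hm : 2 ≤ m) (hn : 1 ≤ n)
    (ψ : ℚ_[p] → ℂˣ)
    (hψ_add : ∀ a b : ℚ_[p], ψ (a + b) = ψ a * ψ b)
    (hψ_cont : Continuous ψ)
    (hψ_triv : ∀ x : ℚ_[p], ‖x‖ ≤ 1 → ψ x = 1)
    (hψ_ne : ∃ x : ℚ_[p], ‖x‖ ≤ (p : ℝ) ∧ ψ x ≠ 1)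
    (hpow : ∀ x : ℚ_[p], ‖x - 1‖ ≤ (p : ℝ) ^ (-(n : ℤ)) → ∃ y : ℚ_[p], y ^ m = x)
    (μ : Measure (Fin m → ℚ_[p])) [IsProbabilityMeasure μ]
    (hμ_supp : μ (AnSet p m n)ᶜ = 0)
    (hμ_inv : ∀ t ∈ AnSet p m n, Measure.map (fun s => t * s) μ = μ)
    (u : Matrix (Fin m) (Fin m) ℚ_[p]) (hu : IsUnipUpper u) :
    (∫ t : Fin m → ℚ_[p],
        ((ψ (sdSumUpTo m (m - 1)
          (Matrix.diagonal t * u * (Matrix.diagonal t)⁻¹)) : ℂ)) ∂μ) =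
      if ∀ i : Fin m, ∀ h : (i : ℕ) + 1 < m, ‖u i ⟨(i : ℕ) + 1, h⟩‖ ≤ (p : ℝ) ^ n
      then (ψ (sdSumUpTo m (m - 1) u) : ℂ) else 0 := by
  have hp : (1 : ℝ) < p := by exact_mod_cast (Fact.out : p.Prime).one_lt
  have hp0 : (0 : ℝ) < p := by linarith
  have hae : ∀ᵐ t ∂μ, t ∈ AnSet p m n := hμ_supp
  have hpn : (p : ℝ) ^ (-(n : ℤ)) * (p : ℝ) ^ n = 1 := by
    rw [_root_.zpow_neg, zpow_natCast]
    exact inv_mul_cancel₀ (pow_pos hp0 n).ne'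
  have hpn_le : (p : ℝ) ^ (-(n : ℤ)) * p ≤ 1 := by
    rw [← hpn]
    gcongr
    exact le_self_pow₀ hp.le (by omega)
  split_ifs with hint
  · have hconst : ∀ᵐ t ∂μ, ((ψ (sdSumUpTo m (m - 1)
        (Matrix.diagonal t * u * (Matrix.diagonal t)⁻¹)) : ℂ)) =
          (ψ (sdSumUpTo m (m - 1) u) : ℂ) := by
      filter_upwards [hae] with t ht
      rw [sdSumUpTo_diagonal_conj t (ne_zero_of_mem_AnSet ht), sdSumUpTo_pred]
      congr 1
      apply eq_of_norm_sub_le_one hψ_add hψ_triv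
      rw [← Finset.sum_sub_distrib]
      refine IsUltrametricDist.norm_sum_le_of_forall_le_of_nonneg zero_le_one fun i _ => ?_
      rw [← sub_one_mul, norm_mul, ← hpn]
      exact mul_le_mul (ht.2 ⟨i, by omega⟩ (by simp only; omega))
        (hint ⟨i, by omega⟩ (by simp only; omega)) (norm_nonneg _) (by positivity)
    rw [integral_congr_ae hconst]
    simp
  · push Not at hint
    obtain ⟨k, hk, huk⟩ := hint
    obtain ⟨y, hy, hψy⟩ := hψ_ne
    set v := u k ⟨(k : ℕ) + 1, hk⟩ with hv
    have hv_pos : 0 < ‖v‖ := (pow_pos hp0 n).trans huk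
    have hv0 : v ≠ 0 := norm_pos_iff.mp hv_pos
    have hv_le : (p : ℝ) ^ (n + 1) ≤ ‖v‖ := by
      have hN := Padic.norm_eq_zpow_neg_valuation hv0
      rw [hN, ← zpow_natCast] at huk ⊢
      have := (zpow_lt_zpow_iff_right₀ hp).mp huk
      exact (zpow_le_zpow_iff_right₀ hp).mpr (by push_cast; omega)
    have hc : ‖(1 + y / v) - 1‖ ≤ (p : ℝ) ^ (-(n : ℤ)) := by
      rw [add_sub_cancel_left, norm_div, div_le_iff₀ hv_pos]
      calc ‖y‖ ≤ p := hy
        _ = (p : ℝ) ^ (-(n : ℤ)) * (p : ℝ) ^ (n + 1) := by rw [pow_succ, ← mul_assoc, hpn, one_mul]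
        _ ≤ _ := by gcongr
    have ha0 : 1 + y / v ≠ 0 := by
      intro h
      rw [h, zero_sub, norm_neg, norm_one] at hc
      nlinarith
    obtain ⟨s, hs, hsq⟩ := exists_mem_AnSet ha0 hc (hpow _ hc) k hk
    have hs0 := ne_zero_of_mem_AnSet hs
    set F : (Fin m → ℚ_[p]) → ℂ := fun t => ((ψ (sdSumUpTo m (m - 1)
      (Matrix.diagonal t * u * (Matrix.diagonal t)⁻¹)) : ℂ)) with hF
    have hshift : ∀ᵐ t ∂μ, F (s * t) = (ψ y : ℂ) * F t := by
      filter_upwards [hae] with t ht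
      have ht0 := ne_zero_of_mem_AnSet ht
      simp only [hF]
      rw [sdSumUpTo_diagonal_conj t ht0,
        sdSumUpTo_diagonal_conj (s * t) fun i => mul_ne_zero (hs0 i) (ht0 i),
        ← Units.val_mul, ← hψ_add]
      congr 1
      apply eq_of_norm_sub_le_one hψ_add hψ_triv
      rw [add_comm y, ← sub_sub, ← Finset.sum_sub_distrib,
        Finset.sum_eq_single (⟨k, by omega⟩ : Fin (m - 1))]
      · have h1 := hsq k hk
        rw [if_pos rfl] at h1
        have h2 : (s * t) k / (s * t) ⟨(k : ℕ) + 1, hk⟩ * v -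
            t k / t ⟨(k : ℕ) + 1, hk⟩ * v - y = (t k / t ⟨(k : ℕ) + 1, hk⟩ - 1) * y := by
          rw [Pi.mul_apply, Pi.mul_apply, mul_div_mul_comm, h1]
          field_simp
          ring
        simp only [Fin.eta, ← hv]
        rw [h2, norm_mul]
        refine le_trans ?_ hpn_le
        exact mul_le_mul (ht.2 k hk) hy (norm_nonneg _) (by positivity)
      · intro i _ hik
        have h1 := hsq ⟨i, by omega⟩ (by simp only; omega)
        rw [if_neg fun h => hik (Fin.ext h)] at h1
        rw [Pi.mul_apply, Pi.mul_apply, mul_div_mul_comm, h1, one_mul, sub_self]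
      · simp
    have hinv : ∫ t, F t ∂μ = (ψ y : ℂ) * ∫ t, F t ∂μ := by
      conv_lhs => rw [← hμ_inv s hs, (measurableEmbedding_mul_left_pi hs0).integral_map]
      rw [integral_congr_ae hshift, integral_const_mul]
    have hψy' : (ψ y : ℂ) ≠ 1 := fun h => hψy (Units.ext h)
    by_contra h0
    exact hψy' (mul_right_cancel₀ h0 (by rw [one_mul]; exact hinv.symm))
end

section
/- (Remark 2.1, for closed subgroups of GL_N(ℚ_p).) Let H be a closed subgroup of GL_N(ℚ_p) and let H' be a closed subgroup of H; equip H and H' with left Haar measures μ_H and μ_{H'}. Let f : H → ℂ be continuous and right-invariant under some compact open subgroup of H. If ∫_H |f(h)| dμ_H(h) < ∞, then ∫_{H'} |f(h')| dμ_{H'}(h') < ∞. -/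
open scoped MatrixGroups
open MeasureTheory

noncomputable instance matrixMeasurableSpace {α : Type*} [MeasurableSpace α] {m n : Type*} :
    MeasurableSpace (Matrix m n α) := MeasurableSpace.pi

open scoped ENNReal

namespace Matrix

variable {n 𝕜 : Type*} [Fintype n] [DecidableEq n] [Field 𝕜] [TopologicalSpace 𝕜]
  [IsTopologicalRing 𝕜] [ContinuousInv₀ 𝕜]

/-- The topology of `GL n 𝕜` is the subspace topology from the space of matrices. -/
theorem isEmbedding_generalLinearGroup_val :
    Topology.IsEmbedding (Units.val : GL n 𝕜 → Matrix n n 𝕜) := by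
  refine Units.isEmbedding_val_mk' (f := fun A : Matrix n n 𝕜 => A⁻¹) ?_
    fun u => (Matrix.coe_units_inv u).symm
  intro A hA
  have hdet : A.det ≠ 0 := ((Matrix.isUnit_iff_isUnit_det A).1 hA).ne_zero
  refine ContinuousAt.continuousWithinAt ?_
  simp only [Matrix.inv_def, Ring.inverse_eq_inv']
  exact ((continuous_id.matrix_det.continuousAt).inv₀ hdet).smul
    continuous_id.matrix_adjugate.continuousAt

theorem secondCountableTopology_generalLinearGroup [SecondCountableTopology 𝕜] :
    SecondCountableTopology (GL n 𝕜) :=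
  haveI : SecondCountableTopology (Matrix n n 𝕜) :=
    inferInstanceAs (SecondCountableTopology (n → n → 𝕜))
  isEmbedding_generalLinearGroup_val.secondCountableTopology

theorem borelSpace_generalLinearGroup [SecondCountableTopology 𝕜] [MeasurableSpace 𝕜]
    [BorelSpace 𝕜] : BorelSpace (GL n 𝕜) := by
  have : BorelSpace (Matrix n n 𝕜) := inferInstanceAs (BorelSpace (n → n → 𝕜))
  constructor
  rw [(isEmbedding_generalLinearGroup_val (n := n) (𝕜 := 𝕜)).eq_induced, borel_comap,
    ← BorelSpace.measurable_eq (α := Matrix n n 𝕜)]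
  rfl

end Matrix

/-- The integral of a function that is constant on the left cosets of an open subgroup is a sum
over these cosets. -/
theorem MeasureTheory.lintegral_comp_quotient_mk {G : Type*} [Group G] [TopologicalSpace G]
    [IsTopologicalGroup G] [SecondCountableTopology G] [MeasurableSpace G] [BorelSpace G]
    (μ : Measure G) [μ.IsMulLeftInvariant] (K : Subgroup G) (hK : IsOpen (K : Set G))
    (F : G ⧸ K → ℝ≥0∞) :
    ∫⁻ g, F (g : G ⧸ K) ∂μ = (∑' q, F q) * μ K := by
  have : DiscreteTopology (G ⧸ K) := QuotientGroup.discreteTopology hK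
  have hopen (q : G ⧸ K) : IsOpen ((fun g : G => (g : G ⧸ K)) ⁻¹' {q}) :=
    (isOpen_discrete _).preimage QuotientGroup.continuous_mk
  have hdisj : Pairwise (Function.onFun Disjoint
      fun q : G ⧸ K => (fun g : G => (g : G ⧸ K)) ⁻¹' {q}) :=
    fun q r hqr => Disjoint.preimage _ (Set.disjoint_singleton.2 hqr)
  have hcount : Countable (G ⧸ K) :=
    hdisj.countable_of_isOpen_disjoint hopen fun q => q.exists_rep
  have hmeas (q : G ⧸ K) : μ ((fun g : G => (g : G ⧸ K)) ⁻¹' {q}) = μ K := by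
    obtain ⟨g, rfl⟩ := QuotientGroup.mk_surjective q
    rw [← measure_preimage_mul μ g⁻¹ (K : Set G)]
    congr 1
    ext x
    simp only [Set.mem_preimage, Set.mem_singleton_iff, SetLike.mem_coe]
    rw [eq_comm, QuotientGroup.eq]
  rw [← setLIntegral_univ, ← Set.preimage_univ (f := fun g : G => (g : G ⧸ K)),
    ← Set.iUnion_of_singleton, Set.preimage_iUnion,
    lintegral_iUnion (fun q => (hopen q).measurableSet) hdisj, ← ENNReal.tsum_mul_right]
  refine tsum_congr fun q => ?_
  rw [setLIntegral_congr_fun (g := fun _ => F q) (hopen q).measurableSet, setLIntegral_const,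
    hmeas]
  intro g hg
  exact congrArg F hg

/-- Integrability of a function constant on the left cosets of a compact open subgroup passes to
closed subgroups. -/
theorem MeasureTheory.lintegral_comp_closedEmbedding_lt_top {G G' : Type*}
    [Group G] [TopologicalSpace G] [IsTopologicalGroup G] [SecondCountableTopology G]
    [MeasurableSpace G] [BorelSpace G]
    [Group G'] [TopologicalSpace G'] [IsTopologicalGroup G'] [SecondCountableTopology G']
    [MeasurableSpace G'] [BorelSpace G']
    (μ : Measure G) [μ.IsHaarMeasure] (μ' : Measure G') [μ'.IsHaarMeasure]
    (φ : G' →* G) (hφ : Topology.IsClosedEmbedding φ)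
    (K : Subgroup G) (hKc : IsCompact (K : Set G)) (hKo : IsOpen (K : Set G))
    (F : G → ℝ≥0∞) (hF : ∀ g, ∀ k ∈ K, F (g * k) = F g) (hint : ∫⁻ g, F g ∂μ < ∞) :
    ∫⁻ g, F (φ g) ∂μ' < ∞ := by
  have hlift (a b : G) (hab : QuotientGroup.leftRel K a b) : F a = F b := by
    rw [← hF a _ (QuotientGroup.leftRel_apply.1 hab), mul_inv_cancel_left]
  let F₁ : G ⧸ K → ℝ≥0∞ := Quotient.lift F hlift
  let K' : Subgroup G' := K.comap φ
  have hK'o : IsOpen (K' : Set G') := hKo.preimage hφ.continuous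
  have hK'c : IsCompact (K' : Set G') := hφ.isCompact_preimage hKc
  let ψ : G' ⧸ K' → G ⧸ K := Quotient.map' φ fun a b hab => by
    rw [QuotientGroup.leftRel_apply] at hab ⊢
    simpa [K'] using hab
  have hψ : Function.Injective ψ := by
    rintro ⟨a⟩ ⟨b⟩ hab
    refine QuotientGroup.eq.2 ?_
    have : (φ a)⁻¹ * φ b ∈ K := QuotientGroup.eq.1 hab
    simpa [K'] using this
  have hG : ∫⁻ g, F g ∂μ = (∑' q, F₁ q) * μ K := lintegral_comp_quotient_mk μ K hKo F₁
  have hG' : ∫⁻ g, F (φ g) ∂μ' = (∑' q, F₁ (ψ q)) * μ' K' :=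
    lintegral_comp_quotient_mk μ' K' hK'o (F₁ ∘ ψ)
  have hsum : ∑' q, F₁ q < ∞ :=
    ENNReal.lt_top_of_mul_ne_top_left (hG ▸ hint.ne)
      (hKo.measure_pos μ ⟨1, K.one_mem⟩).ne'
  rw [hG']
  exact ENNReal.mul_lt_top ((ENNReal.tsum_comp_le_tsum_of_injective hψ F₁).trans_lt hsum)
    hK'c.measure_lt_top

/-- **Remark 2.1 for closed subgroups of `GL_N(ℚ_p)`.**  Let `H' ≤ H` be closed subgroups of
`GL_N(ℚ_p)` with left Haar measures `μ_H`, `μ_{H'}`.  If `f : H → ℂ` is continuous and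
right-invariant under some compact open subgroup of `H`, and `∫_H |f| dμ_H < ∞`, then
`∫_{H'} |f| dμ_{H'} < ∞`. -/
theorem remark_2_1
    (p : ℕ) [Fact p.Prime] (N : ℕ)
    (H H' : Subgroup (GL (Fin N) ℚ_[p]))
    (hH_closed : IsClosed (H : Set (GL (Fin N) ℚ_[p])))
    (hH'_closed : IsClosed (H' : Set (GL (Fin N) ℚ_[p])))
    (hle : H' ≤ H)
    (μH : Measure ↥H) [μH.IsHaarMeasure]
    (μH' : Measure ↥H') [μH'.IsHaarMeasure]
    (f : ↥H → ℂ)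
    (hf_cont : Continuous f)
    (hf_smooth : ∃ K₀ : Subgroup ↥H,
      IsCompact (K₀ : Set ↥H) ∧ IsOpen (K₀ : Set ↥H) ∧
      ∀ h : ↥H, ∀ k ∈ K₀, f (h * k) = f h)
    (hf_int : (∫⁻ h : ↥H, (‖f h‖₊ : ENNReal) ∂μH) < ⊤) :
    (∫⁻ h' : ↥H', (‖f (Subgroup.inclusion hle h')‖₊ : ENNReal) ∂μH') < ⊤ := by
  have := Matrix.secondCountableTopology_generalLinearGroup (n := Fin N) (𝕜 := ℚ_[p])
  have := Matrix.borelSpace_generalLinearGroup (n := Fin N) (𝕜 := ℚ_[p])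
  obtain ⟨K, hKc, hKo, hK⟩ := hf_smooth
  have hemb : Topology.IsClosedEmbedding (Subgroup.inclusion hle) :=
    .of_comp (g := ((↑) : H → GL (Fin N) ℚ_[p])) .subtypeVal
      hH'_closed.isClosedEmbedding_subtypeVal
  have : SecondCountableTopology H :=
    TopologicalSpace.Subtype.secondCountableTopology (H : Set (GL (Fin N) ℚ_[p]))
  have : SecondCountableTopology H' :=
    TopologicalSpace.Subtype.secondCountableTopology (H' : Set (GL (Fin N) ℚ_[p]))
  exact lintegral_comp_closedEmbedding_lt_top μH μH' (Subgroup.inclusion hle) hemb K hKc hKo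
    (fun h => (‖f h‖₊ : ℝ≥0∞)) (fun h k hk => by simp only [hK h k hk]) hf_int
end

section
/- (§2.6: compactness of generated subgroups in unipotent p-adic groups.) Let m ≥ 1 and let N_m be the group of upper triangular m×m matrices over ℚ_p with all diagonal entries equal to 1, with the topology induced from Mat_m(ℚ_p). If S is a relatively compact subset of N_m, then the subgroup of N_m generated by S is relatively compact. Consequently, every compact subset of N_m is contained in a compact open subgroup of N_m, and the set of compact open subgroups of N_m is directed under inclusion (any two are contained in a common compact open subgroup). -/
open scoped MatrixGroups
open Matrix

/-- The group `N_m` of upper triangular unipotent matrices, as a subset of `GL_m(ℚ_p)`. -/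
def NmSet (p : ℕ) [Fact p.Prime] (m : ℕ) : Set (GL (Fin m) ℚ_[p]) :=
  {g | IsUnipUpper (g : Matrix (Fin m) (Fin m) ℚ_[p])}

/-- Unipotent upper triangular matrices are closed under multiplication. -/
theorem IsUnipUpper.mul {R : Type*} [Semiring R] {m : ℕ} {A B : Matrix (Fin m) (Fin m) R}
    (hA : IsUnipUpper A) (hB : IsUnipUpper B) : IsUnipUpper (A * B) := by
  refine ⟨fun i j hij => ?_, fun i => ?_⟩
  · rw [Matrix.mul_apply]
    refine Finset.sum_eq_zero fun k _ => ?_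
    rcases lt_or_ge (k : ℕ) i with h | h
    · rw [hA.1 i k h, zero_mul]
    · rw [hB.1 k j (by omega), mul_zero]
  · rw [Matrix.mul_apply, Finset.sum_eq_single i, hA.2, hB.2, one_mul]
    · intro k _ hk
      rcases lt_or_gt_of_ne (Fin.val_ne_of_ne hk) with h | h
      · rw [hA.1 i k h, zero_mul]
      · rw [hB.1 k i h, mul_zero]
    · simp

theorem isUnipUpper_one {R : Type*} [Zero R] [One R] {m : ℕ} :
    IsUnipUpper (1 : Matrix (Fin m) (Fin m) R) :=
  ⟨fun _ _ hij => Matrix.one_apply_ne (Fin.ne_of_gt hij), fun _ => Matrix.one_apply_eq _⟩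

/-- The inverse of a unipotent upper triangular matrix is unipotent upper triangular. -/
theorem IsUnipUpper.inv {R : Type*} [CommRing R] {m : ℕ} {g : GL (Fin m) R}
    (hg : IsUnipUpper (g : Matrix (Fin m) (Fin m) R)) :
    IsUnipUpper ((g⁻¹ : GL (Fin m) R) : Matrix (Fin m) (Fin m) R) := by
  have htri : ∀ i j : Fin m, (j : ℕ) < i →
      ((g⁻¹ : GL (Fin m) R) : Matrix (Fin m) (Fin m) R) i j = 0 := by
    have hb : Matrix.BlockTriangular (g : Matrix (Fin m) (Fin m) R) id :=
      fun i j hij => hg.1 i j hij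
    have := Matrix.blockTriangular_inv_of_blockTriangular hb
    intro i j hij
    rw [Matrix.coe_units_inv]
    exact this hij
  refine ⟨htri, fun i => ?_⟩
  have h : ((g : Matrix (Fin m) (Fin m) R) *
      ((g⁻¹ : GL (Fin m) R) : Matrix (Fin m) (Fin m) R)) i i = 1 := by
    rw [Units.mul_inv, Matrix.one_apply_eq]
  rw [Matrix.mul_apply, Finset.sum_eq_single i, hg.2, one_mul] at h
  · exact h
  · intro k _ hk
    rcases lt_or_gt_of_ne (Fin.val_ne_of_ne hk) with h | h
    · rw [hg.1 i k h, zero_mul]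
    · rw [htri k i h, mul_zero]
  · simp

/-- Matrices whose `(i, j)` entry has norm at most `r ^ (j - i)`. -/
def weightedBall (K : Type*) [Norm K] (m : ℕ) (r : ℝ) : Set (Matrix (Fin m) (Fin m) K) :=
  {A | ∀ i j : Fin m, ‖A i j‖ ≤ r ^ ((j : ℤ) - (i : ℤ))}

theorem one_mem_weightedBall {K : Type*} [NormedField K] {m : ℕ} {r : ℝ} (hr : 0 < r) :
    (1 : Matrix (Fin m) (Fin m) K) ∈ weightedBall K m r := by
  intro i j
  rcases eq_or_ne i j with rfl | h
  · simp
  · rw [Matrix.one_apply_ne h, norm_zero]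
    positivity

theorem mul_mem_weightedBall {K : Type*} [NormedField K] [IsUltrametricDist K] {m : ℕ} {r : ℝ}
    (hr : 0 < r) {A B : Matrix (Fin m) (Fin m) K} (hA : A ∈ weightedBall K m r)
    (hB : B ∈ weightedBall K m r) : A * B ∈ weightedBall K m r := by
  intro i j
  rw [Matrix.mul_apply]
  refine IsUltrametricDist.norm_sum_le_of_forall_le_of_nonneg (by positivity) fun k _ => ?_
  calc ‖A i k * B k j‖ = ‖A i k‖ * ‖B k j‖ := norm_mul _ _
    _ ≤ r ^ ((k : ℤ) - (i : ℤ)) * r ^ ((j : ℤ) - (k : ℤ)) :=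
      mul_le_mul (hA i k) (hB k j) (norm_nonneg _) (by positivity)
    _ = r ^ ((j : ℤ) - (i : ℤ)) := by
      rw [← zpow_add₀ hr.ne']
      congr 1
      ring

theorem weightedBall_eq_pi (K : Type*) [NormedField K] (m : ℕ) (r : ℝ) :
    weightedBall K m r = (Set.univ.pi fun i : Fin m => Set.univ.pi fun j : Fin m =>
      Metric.closedBall (0 : K) (r ^ ((j : ℤ) - (i : ℤ))) : Set (Fin m → Fin m → K)) := by
  ext A
  exact ⟨fun h i _ j _ => mem_closedBall_zero_iff.2 (h i j),
    fun h i j => mem_closedBall_zero_iff.1 (h i (Set.mem_univ i) j (Set.mem_univ j))⟩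

theorem isCompact_weightedBall {K : Type*} [NormedField K] [ProperSpace K] (m : ℕ) (r : ℝ) :
    IsCompact (weightedBall K m r) := by
  rw [weightedBall_eq_pi]
  exact isCompact_univ_pi fun i => isCompact_univ_pi fun j => isCompact_closedBall _ _

theorem isOpen_weightedBall {K : Type*} [NormedField K] [IsUltrametricDist K] (m : ℕ) {r : ℝ}
    (hr : 0 < r) : IsOpen (weightedBall K m r) := by
  rw [weightedBall_eq_pi]
  exact isOpen_set_pi Set.finite_univ fun i _ => isOpen_set_pi Set.finite_univ fun j _ =>
    IsUltrametricDist.isOpen_closedBall _ (by positivity)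

theorem isClosed_setOf_isUnipUpper {R : Type*} [Zero R] [One R] [TopologicalSpace R] [T1Space R]
    (m : ℕ) : IsClosed {A : Matrix (Fin m) (Fin m) R | IsUnipUpper A} := by
  have hc (i j : Fin m) : Continuous fun A : Matrix (Fin m) (Fin m) R => A i j :=
    continuous_id.matrix_elem i j
  simp only [IsUnipUpper, Set.ofPred_and, Set.ofPred_forall]
  exact (isClosed_iInter fun i => isClosed_iInter fun j => isClosed_iInter fun _ =>
    isClosed_singleton.preimage (hc i j)).inter
      (isClosed_iInter fun i => isClosed_singleton.preimage (hc i i))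

theorem isClosed_NmSet (p : ℕ) [Fact p.Prime] (m : ℕ) : IsClosed (NmSet p m) :=
  (isClosed_setOf_isUnipUpper m).preimage Units.continuous_val

/-- The elements of `N_m` which, together with their inverses, lie in `weightedBall ℚ_[p] m r`. -/
def weightedSubgroup (p : ℕ) [Fact p.Prime] (m : ℕ) {r : ℝ} (hr : 0 < r) :
    Subgroup (GL (Fin m) ℚ_[p]) where
  carrier := {g | g ∈ NmSet p m ∧ (g : Matrix (Fin m) (Fin m) ℚ_[p]) ∈ weightedBall ℚ_[p] m r ∧
    ((g⁻¹ : GL (Fin m) ℚ_[p]) : Matrix (Fin m) (Fin m) ℚ_[p]) ∈ weightedBall ℚ_[p] m r}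
  one_mem' := by
    refine ⟨isUnipUpper_one, one_mem_weightedBall hr, ?_⟩
    rw [inv_one]
    exact one_mem_weightedBall hr
  mul_mem' := by
    rintro g h ⟨hg, hg₁, hg₂⟩ ⟨hh, hh₁, hh₂⟩
    refine ⟨IsUnipUpper.mul hg hh, mul_mem_weightedBall hr hg₁ hh₁, ?_⟩
    rw [_root_.mul_inv_rev]
    exact mul_mem_weightedBall hr hh₂ hg₂
  inv_mem' := by
    rintro g ⟨hg, hg₁, hg₂⟩
    refine ⟨IsUnipUpper.inv hg, hg₂, ?_⟩
    rwa [inv_inv]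

theorem weightedSubgroup_subset_NmSet (p : ℕ) [Fact p.Prime] (m : ℕ) {r : ℝ} (hr : 0 < r) :
    (weightedSubgroup p m hr : Set (GL (Fin m) ℚ_[p])) ⊆ NmSet p m :=
  fun _ hg => hg.1

theorem isCompact_weightedSubgroup (p : ℕ) [Fact p.Prime] (m : ℕ) {r : ℝ} (hr : 0 < r) :
    IsCompact (weightedSubgroup p m hr : Set (GL (Fin m) ℚ_[p])) := by
  have hB := isCompact_weightedBall (K := ℚ_[p]) m r
  have h := (Units.isClosedEmbedding_embedProduct
    (α := Matrix (Fin m) (Fin m) ℚ_[p])).isCompact_preimage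
      (hB.prod (hB.image MulOpposite.continuous_op))
  convert h.inter_left (isClosed_NmSet p m) using 1
  ext g
  refine and_congr_right fun _ => and_congr_right fun _ => ?_
  exact ⟨fun hg => ⟨_, hg, rfl⟩, fun ⟨A, hA, hAg⟩ => MulOpposite.op_injective hAg ▸ hA⟩

theorem exists_isOpen_weightedSubgroup_eq_inter (p : ℕ) [Fact p.Prime] (m : ℕ) {r : ℝ}
    (hr : 0 < r) : ∃ V : Set (GL (Fin m) ℚ_[p]), IsOpen V ∧
      (weightedSubgroup p m hr : Set (GL (Fin m) ℚ_[p])) = V ∩ NmSet p m := by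
  have hB := isOpen_weightedBall (K := ℚ_[p]) m hr
  refine ⟨_, (hB.preimage Units.continuous_val).inter
    ((hB.preimage Units.continuous_val).preimage continuous_inv), ?_⟩
  ext g
  exact and_comm

theorem exists_norm_apply_le_of_isCompact {K : Type*} [NormedField K] {m : ℕ}
    {C : Set (GL (Fin m) K)} (hC : IsCompact C) :
    ∃ r : ℝ, ∀ g ∈ C, ∀ i j, ‖(g : Matrix (Fin m) (Fin m) K) i j‖ ≤ r := by
  have h (i j : Fin m) : ∃ c : ℝ, ∀ g ∈ C, ‖(g : Matrix (Fin m) (Fin m) K) i j‖ ≤ c :=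
    hC.exists_bound_of_continuousOn (Units.continuous_val.matrix_elem i j).continuousOn
  choose c hc using h
  obtain ⟨r, hr⟩ := (Set.finite_range fun x : Fin m × Fin m => c x.1 x.2).bddAbove
  exact ⟨r, fun g hg i j => (hc i j g hg).trans (hr ⟨(i, j), rfl⟩)⟩

theorem IsUnipUpper.mem_weightedBall {K : Type*} [NormedField K] {m : ℕ} {r : ℝ} (hr : 1 ≤ r)
    {A : Matrix (Fin m) (Fin m) K} (hA : IsUnipUpper A) (h : ∀ i j, ‖A i j‖ ≤ r) :
    A ∈ weightedBall K m r := by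
  intro i j
  rcases lt_trichotomy i j with hij | rfl | hij
  · refine (h i j).trans (le_trans (zpow_one r).ge (zpow_le_zpow_right₀ hr ?_))
    have : (i : ℕ) < j := hij
    omega
  · simp [hA.2]
  · rw [hA.1 i j hij, norm_zero]
    positivity

theorem exists_subset_weightedSubgroup {p : ℕ} [Fact p.Prime] {m : ℕ}
    {C : Set (GL (Fin m) ℚ_[p])} (hCN : C ⊆ NmSet p m) (hC : IsCompact C) :
    ∃ (r : ℝ) (hr : 0 < r), C ⊆ weightedSubgroup p m hr := by
  obtain ⟨r₁, h₁⟩ := exists_norm_apply_le_of_isCompact hC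
  obtain ⟨r₂, h₂⟩ := exists_norm_apply_le_of_isCompact hC.inv
  have hr : 1 ≤ max 1 (max r₁ r₂) := le_max_left _ _
  refine ⟨max 1 (max r₁ r₂), zero_lt_one.trans_le hr, fun g hg => ⟨hCN hg, ?_, ?_⟩⟩
  · exact IsUnipUpper.mem_weightedBall hr (hCN hg) fun i j => (h₁ g hg i j).trans (by simp)
  · exact IsUnipUpper.mem_weightedBall hr (IsUnipUpper.inv (hCN hg)) fun i j =>
      (h₂ g⁻¹ (Set.inv_mem_inv.2 hg) i j).trans (by simp)

/-- **§2.6: compactness of generated subgroups in unipotent `p`-adic groups.**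
(1) If `S` is a relatively compact subset of `N_m`, the subgroup generated by `S` is relatively
compact.  Consequently (2) every compact subset of `N_m` is contained in a compact open subgroup
of `N_m`, and (3) the set of compact open subgroups of `N_m` is directed under inclusion. -/
theorem unipotent_generated_subgroup_relatively_compact
    (p : ℕ) [Fact p.Prime] (m : ℕ) (hm : 1 ≤ m) :
    (∀ S : Set (GL (Fin m) ℚ_[p]), S ⊆ NmSet p m → IsCompact (closure S) →
      IsCompact (closure ((Subgroup.closure S : Subgroup (GL (Fin m) ℚ_[p])) :
        Set (GL (Fin m) ℚ_[p])))) ∧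
    (∀ C : Set (GL (Fin m) ℚ_[p]), C ⊆ NmSet p m → IsCompact C →
      ∃ K : Subgroup (GL (Fin m) ℚ_[p]),
        (K : Set (GL (Fin m) ℚ_[p])) ⊆ NmSet p m ∧
        IsCompact (K : Set (GL (Fin m) ℚ_[p])) ∧
        (∃ V : Set (GL (Fin m) ℚ_[p]), IsOpen V ∧ (K : Set (GL (Fin m) ℚ_[p])) = V ∩ NmSet p m) ∧
        C ⊆ (K : Set (GL (Fin m) ℚ_[p]))) ∧
    (∀ K₁ K₂ : Subgroup (GL (Fin m) ℚ_[p]),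
      (K₁ : Set (GL (Fin m) ℚ_[p])) ⊆ NmSet p m →
      IsCompact (K₁ : Set (GL (Fin m) ℚ_[p])) →
      (∃ V : Set (GL (Fin m) ℚ_[p]), IsOpen V ∧ (K₁ : Set (GL (Fin m) ℚ_[p])) = V ∩ NmSet p m) →
      (K₂ : Set (GL (Fin m) ℚ_[p])) ⊆ NmSet p m →
      IsCompact (K₂ : Set (GL (Fin m) ℚ_[p])) →
      (∃ V : Set (GL (Fin m) ℚ_[p]), IsOpen V ∧ (K₂ : Set (GL (Fin m) ℚ_[p])) = V ∩ NmSet p m) →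
      ∃ K₃ : Subgroup (GL (Fin m) ℚ_[p]),
        (K₃ : Set (GL (Fin m) ℚ_[p])) ⊆ NmSet p m ∧
        IsCompact (K₃ : Set (GL (Fin m) ℚ_[p])) ∧
        (∃ V : Set (GL (Fin m) ℚ_[p]), IsOpen V ∧ (K₃ : Set (GL (Fin m) ℚ_[p])) = V ∩ NmSet p m) ∧
        K₁ ≤ K₃ ∧ K₂ ≤ K₃) := by
  have exists_subgroup : ∀ C : Set (GL (Fin m) ℚ_[p]), C ⊆ NmSet p m → IsCompact C →
      ∃ K : Subgroup (GL (Fin m) ℚ_[p]),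
        (K : Set (GL (Fin m) ℚ_[p])) ⊆ NmSet p m ∧
        IsCompact (K : Set (GL (Fin m) ℚ_[p])) ∧
        (∃ V : Set (GL (Fin m) ℚ_[p]), IsOpen V ∧ (K : Set (GL (Fin m) ℚ_[p])) = V ∩ NmSet p m) ∧
        C ⊆ (K : Set (GL (Fin m) ℚ_[p])) := by
    intro C hCN hC
    obtain ⟨r, hr, hCr⟩ := exists_subset_weightedSubgroup hCN hC
    exact ⟨weightedSubgroup p m hr, weightedSubgroup_subset_NmSet p m hr,
      isCompact_weightedSubgroup p m hr, exists_isOpen_weightedSubgroup_eq_inter p m hr, hCr⟩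
  refine ⟨fun S hSN hS => ?_, exists_subgroup, fun K₁ K₂ hN₁ hc₁ _ hN₂ hc₂ _ => ?_⟩
  · obtain ⟨K, -, hK, -, hSK⟩ :=
      exists_subgroup _ (closure_minimal hSN (isClosed_NmSet p m)) hS
    exact hK.closure_of_subset ((Subgroup.closure_le K).2 (subset_closure.trans hSK))
  · obtain ⟨K, hKN, hK, hKo, hsub⟩ :=
      exists_subgroup _ (Set.union_subset hN₁ hN₂) (hc₁.union hc₂)
    exact ⟨K, hKN, hK, hKo, Set.subset_union_left.trans hsub, Set.subset_union_right.trans hsub⟩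
end
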